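/- For every ε > 0 there exists a finite metric probability space (X, ρ, μ) with diam(X) < Δ_SG(X) + ε. Concretely, for every ε > 0 there exists N ∈ ℕ such that the N-point space X = {1, …, N} with the discrete metric ρ(x, x') = 1 for x ≠ x' (so diam(X) = 1) and the uniform probability measure μ satisfies Δ_SG(X) > 1 − ε. -/

import Mathlib

open MeasureTheory Real
open scoped ENNReal

/-- The moment generating function of the symmetrized distance `Ξ(X) = ε·ρ(Y,Y')` for an
explicitly given metric `ρ`, where `Y, Y' ~ μ` are independent and `ε` is an independent
uniform sign: `E[e^{λΞ}] = E[(e^{λρ(Y,Y')} + e^{-λρ(Y,Y')})/2]`. -/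
noncomputable def mgfXiFn {X : Type*} [MeasurableSpace X] (ρ : X → X → ℝ)
    (μ : Measure X) (l : ℝ) : ℝ≥0∞ :=
  ∫⁻ y, ∫⁻ y', ENNReal.ofReal
    ((Real.exp (l * ρ y y') + Real.exp (-(l * ρ y y'))) / 2) ∂μ ∂μ

/-- The subgaussian diameter `Δ_SG(X) = σ*(Ξ(X))` of the metric probability space
`(X, ρ, μ)`: the smallest `σ ≥ 0` such that `E[e^{λΞ}] ≤ e^{σ²λ²/2}` for all `λ`. -/
noncomputable def subgDiamFn {X : Type*} [MeasurableSpace X] (ρ : X → X → ℝ)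
    (μ : Measure X) : ℝ :=
  sInf {σ : ℝ | 0 ≤ σ ∧ ∀ l : ℝ, mgfXiFn ρ μ l ≤ ENNReal.ofReal (Real.exp (σ ^ 2 * l ^ 2 / 2))}

/-- The second-order Taylor lower bound for `cosh` at nonnegative points. -/
lemma one_add_sq_div_two_le_cosh {x : ℝ} (hx : 0 ≤ x) : 1 + x ^ 2 / 2 ≤ Real.cosh x := by
  have h1 : x / 2 ≤ Real.sinh (x / 2) := Real.self_le_sinh_iff.2 (by linarith)
  have h2 := Real.cosh_two_mul (x / 2)
  rw [mul_div_cancel₀ x two_ne_zero, Real.cosh_sq] at h2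
  nlinarith

/-- The moment generating function of the symmetrized distance on the uniform discrete space. -/
lemma mgfXiFn_discrete_uniform (N : ℕ) (l : ℝ) :
    mgfXiFn (fun x y : Fin (N + 2) => if x = y then 0 else 1)
        (PMF.uniformOfFintype (Fin (N + 2))).toMeasure l =
      ENNReal.ofReal (1 + (1 - 1 / ((N : ℝ) + 2)) * (Real.cosh l - 1)) := by
  have hN : (0 : ℝ) < (N : ℝ) + 2 := by positivity
  have hmass : ∀ y : Fin (N + 2), (PMF.uniformOfFintype (Fin (N + 2))).toMeasure {y} =
      ENNReal.ofReal (1 / ((N : ℝ) + 2)) := by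
    intro y
    rw [PMF.toMeasure_apply_singleton _ _ (measurableSet_singleton y),
      PMF.uniformOfFintype_apply, Fintype.card_fin, one_div, ENNReal.ofReal_inv_of_pos hN]
    congr 1
    rw [← ENNReal.ofReal_natCast]
    push_cast
    rfl
  have hcosh : ∀ y y' : Fin (N + 2),
      (Real.exp (l * (if y = y' then (0 : ℝ) else 1)) +
        Real.exp (-(l * (if y = y' then (0 : ℝ) else 1)))) / 2 =
      Real.cosh l + (if y = y' then 1 - Real.cosh l else 0) := by
    intro y y'
    split_ifs
    · simp
    · simp [Real.cosh_eq]
  have hpos : ∀ y y' : Fin (N + 2),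
      0 ≤ Real.cosh l + (if y = y' then 1 - Real.cosh l else 0) := by
    intro y y'
    rw [← hcosh]
    positivity
  have hinner : ∀ y : Fin (N + 2),
      ∫⁻ y', ENNReal.ofReal (Real.cosh l + (if y = y' then 1 - Real.cosh l else 0))
        ∂(PMF.uniformOfFintype (Fin (N + 2))).toMeasure =
      ENNReal.ofReal (1 + (1 - 1 / ((N : ℝ) + 2)) * (Real.cosh l - 1)) := by
    intro y
    rw [lintegral_fintype]
    simp_rw [hmass, ← ENNReal.ofReal_mul (hpos y _)]
    rw [← ENNReal.ofReal_sum_of_nonneg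
      (fun y' _ => mul_nonneg (hpos y y') (by positivity)), ← Finset.sum_mul,
      Finset.sum_add_distrib]
    congr 1
    simp only [Finset.sum_const, Finset.card_univ, Fintype.card_fin, nsmul_eq_mul,
      Finset.sum_ite_eq, Finset.mem_univ, if_true]
    push_cast
    field_simp
    ring
  unfold mgfXiFn
  simp_rw [hcosh, hinner]
  simp

/-- If `1 + p t ≤ e^{s t}` for all `t > 0`, then `p ≤ s`. -/
lemma le_of_forall_one_add_mul_le_exp {p s : ℝ} (hp : p ≤ 1) (hs : 0 ≤ s)
    (h : ∀ t : ℝ, 0 < t → 1 + p * t ≤ Real.exp (s * t)) : p ≤ s := by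
  by_contra! hlt
  have ht : 0 < (p - s) / 2 := by linarith
  have hst : s * ((p - s) / 2) < 1 := by nlinarith
  have hexp := Real.one_sub_le_exp_neg (s * ((p - s) / 2))
  have hmul : Real.exp (s * ((p - s) / 2)) * Real.exp (-(s * ((p - s) / 2))) = 1 := by
    rw [← Real.exp_add]
    simp
  have h1 : (1 + p * ((p - s) / 2)) * (1 - s * ((p - s) / 2)) ≤ 1 := by
    exact (mul_le_mul (h _ ht) hexp (by linarith) (Real.exp_pos _).le).trans_eq hmul
  have hps : p * s ≤ 1 := by nlinarith
  nlinarith [mul_pos ht ht, mul_le_mul_of_nonneg_right hps (mul_pos ht ht).le]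

/-- For every `ε > 0` there is a finite metric probability space — namely `{1, …, N}` with the
discrete metric `ρ(x,x') = 1` for `x ≠ x'` (so that `diam = 1`) and the uniform probability
measure — whose subgaussian diameter exceeds `1 - ε`. -/
theorem exists_discrete_space_subgDiam_gt (ε : ℝ) (hε : 0 < ε) :
    ∃ N : ℕ, 2 ≤ N + 2 ∧
      1 - ε < subgDiamFn (fun x y : Fin (N + 2) => if x = y then 0 else 1)
        (PMF.uniformOfFintype (Fin (N + 2))).toMeasure := by
  obtain ⟨N, hN⟩ := exists_nat_one_div_lt hε
  refine ⟨N, by omega, ?_⟩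
  have hq : 1 / ((N : ℝ) + 2) ≤ 1 / ((N : ℝ) + 1) := by
    gcongr
    norm_num
  have hq0 : 0 < 1 / ((N : ℝ) + 2) := by positivity
  have hq1 : 1 / ((N : ℝ) + 2) ≤ 1 := by
    rw [div_le_one (by positivity)]
    linarith [(Nat.cast_nonneg N : (0 : ℝ) ≤ N)]
  refine lt_of_lt_of_le (by linarith : 1 - ε < 1 - 1 / ((N : ℝ) + 2)) ?_
  unfold subgDiamFn
  simp_rw [mgfXiFn_discrete_uniform]
  refine le_csInf ⟨1, zero_le_one, fun l => ENNReal.ofReal_le_ofReal ?_⟩ ?_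
  · have h1 := Real.cosh_le_exp_half_sq l
    have h2 := Real.one_le_cosh l
    rw [one_pow, one_mul]
    nlinarith
  · rintro σ ⟨hσ, h⟩
    have hsq : 1 - 1 / ((N : ℝ) + 2) ≤ σ ^ 2 := by
      refine le_of_forall_one_add_mul_le_exp (by linarith) (sq_nonneg σ) fun t ht => ?_
      have hl := (ENNReal.ofReal_le_ofReal_iff (Real.exp_pos _).le).1 (h (√(2 * t)))
      have hsqrt : √(2 * t) ^ 2 = 2 * t := Real.sq_sqrt (by linarith)
      have hc := one_add_sq_div_two_le_cosh (Real.sqrt_nonneg (2 * t))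
      rw [hsqrt] at hl hc
      rw [show σ ^ 2 * (2 * t) / 2 = σ ^ 2 * t by ring] at hl
      refine le_trans ?_ hl
      have := mul_le_mul_of_nonneg_left (by linarith : t ≤ Real.cosh (√(2 * t)) - 1)
        (by linarith : 0 ≤ 1 - 1 / ((N : ℝ) + 2))
      linarith
    by_contra! hlt
    nlinarith
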